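/- Let d ≥ 1, C > 0, and let W : ℝ^d → ℝ be smooth with |∂^β W(x)| ≤ C^{|β|+1} β! for all x ∈ ℝ^d and all multi-indices β with |β| ≥ 1. Then there exist ε > 0 and C' > 0 such that for every N ∈ ℕ and every u ∈ 𝒮(ℝ^d): |Re Σ_{|α|≤N} (ε^{2|α|}/α!²)·⟨i·∂^α(W·u), ∂^α u⟩| ≤ C' · Σ_{|α|≤N} (ε^{2|α|}/α!²)·‖∂^α u‖². -/

import Mathlib

open MeasureTheory Complex Filter
open scoped BigOperators RealInnerProductSpace

noncomputable section

/-- Euclidean space `ℝ^d`. -/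
abbrev Ed (d : ℕ) : Type := EuclideanSpace ℝ (Fin d)

/-- Partial derivative in the `j`-th coordinate direction. -/
def pd {F : Type*} [NormedAddCommGroup F] [NormedSpace ℝ F]
    (d : ℕ) (j : Fin d) (f : Ed d → F) : Ed d → F :=
  fun x => fderiv ℝ f x (EuclideanSpace.single j 1)

/-- Iterated partial derivative `∂^α` for a multi-index `α : Fin d → ℕ`. -/
def md {F : Type*} [NormedAddCommGroup F] [NormedSpace ℝ F]
    {d : ℕ} (α : Fin d → ℕ) (f : Ed d → F) : Ed d → F :=
  (List.finRange d).foldr (fun j g => (pd d j)^[α j] g) f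

/-- Length `|α| = α₁ + ⋯ + α_d` of a multi-index. -/
def mlen {d : ℕ} (α : Fin d → ℕ) : ℕ := ∑ j, α j

/-- `L²` inner product `⟨f, g⟩ = ∫ f(x) conj(g(x)) dx` (antilinear in the second factor). -/
def ip {d : ℕ} (f g : Ed d → ℂ) : ℂ := ∫ x, f x * (starRingEnd ℂ) (g x)

/-- Square `‖f‖²` of the `L²` norm. -/
def l2sq {d : ℕ} (f : Ed d → ℂ) : ℝ := ∫ x, ‖f x‖ ^ 2

/-- The finite set of multi-indices `α : Fin d → ℕ` with `|α| ≤ N`. -/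
def MI (d N : ℕ) : Finset (Fin d → ℕ) :=
  (Finset.Iic fun _ : Fin d => N).filter fun α => ∑ j, α j ≤ N

/-- The factorial `α! = α₁!⋯α_d!` of a multi-index. -/
def mfact {d : ℕ} (α : Fin d → ℕ) : ℕ := ∏ j, Nat.factorial (α j)

/-- The binomial coefficient `binom(α,β) = Π binom(α_j, β_j)` of two multi-indices. -/
def mchoose {d : ℕ} (α β : Fin d → ℕ) : ℕ := ∏ j, Nat.choose (α j) (β j)

section MultiIndexDerivatives

variable {F : Type*} [NormedAddCommGroup F] [NormedSpace ℝ F] {d : ℕ}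

theorem contDiff_pd (j : Fin d) {f : Ed d → F} (hf : ContDiff ℝ (⊤ : ℕ∞) f) :
    ContDiff ℝ (⊤ : ℕ∞) (pd d j f) :=
  (hf.fderiv_right (m := ((⊤ : ℕ∞) : WithTop ℕ∞)) (by norm_cast)).clm_apply contDiff_const

theorem contDiff_iterate_pd (j : Fin d) (n : ℕ) {f : Ed d → F}
    (hf : ContDiff ℝ (⊤ : ℕ∞) f) : ContDiff ℝ (⊤ : ℕ∞) ((pd d j)^[n] f) := by
  induction n with
  | zero => exact hf
  | succ n ih => rw [Function.iterate_succ_apply']; exact contDiff_pd j ih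

theorem pd_sum (j : Fin d) {ι : Type*} (s : Finset ι) {f : ι → Ed d → F}
    (hf : ∀ i, ContDiff ℝ (⊤ : ℕ∞) (f i)) :
    pd d j (fun x => ∑ i ∈ s, f i x) = fun x => ∑ i ∈ s, pd d j (f i) x := by
  funext x
  simp only [pd]
  rw [fderiv_fun_sum fun i _ => (hf i).differentiable (by simp) x]
  simp

theorem pd_nsmul (j : Fin d) (c : ℕ) (f : Ed d → F) :
    pd d j (fun x => c • f x) = fun x => c • pd d j f x := by
  funext x
  have h : (fun y => c • f y) = (c : ℝ) • f := by
    funext y; simp [Nat.cast_smul_eq_nsmul]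
  simp only [pd]
  rw [h, fderiv_const_smul_field]
  simp [Nat.cast_smul_eq_nsmul]

theorem contDiff_nsmul (c : ℕ) {f : Ed d → F} (hf : ContDiff ℝ (⊤ : ℕ∞) f) :
    ContDiff ℝ (⊤ : ℕ∞) fun x => c • f x := by
  have h : ContDiff ℝ (⊤ : ℕ∞) fun x => (c : ℝ) • f x := contDiff_const.smul hf
  simpa only [Nat.cast_smul_eq_nsmul] using h

theorem iterate_pd_sum_nsmul (j : Fin d) (n : ℕ) {ι : Type*} (s : Finset ι) (c : ι → ℕ)
    {f : ι → Ed d → F} (hf : ∀ i, ContDiff ℝ (⊤ : ℕ∞) (f i)) :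
    (pd d j)^[n] (fun x => ∑ i ∈ s, c i • f i x) =
      fun x => ∑ i ∈ s, c i • (pd d j)^[n] (f i) x := by
  induction n with
  | zero => rfl
  | succ n ih =>
    simp only [Function.iterate_succ_apply', ih]
    rw [pd_sum j s fun i => contDiff_nsmul (c i) (contDiff_iterate_pd j n (hf i))]
    simp only [pd_nsmul]

theorem pd_smul (j : Fin d) {f : Ed d → ℝ} {g : Ed d → F}
    (hf : ContDiff ℝ (⊤ : ℕ∞) f) (hg : ContDiff ℝ (⊤ : ℕ∞) g) :
    pd d j (fun x => f x • g x) = fun x => f x • pd d j g x + pd d j f x • g x := by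
  funext x
  simp only [pd]
  rw [fderiv_fun_smul (hf.differentiable (by simp) x) (hg.differentiable (by simp) x)]
  simp

/-- Leibniz rule for iterated derivatives in one coordinate direction. -/
theorem iterate_pd_smul (j : Fin d) (n : ℕ) {f : Ed d → ℝ} {g : Ed d → F}
    (hf : ContDiff ℝ (⊤ : ℕ∞) f) (hg : ContDiff ℝ (⊤ : ℕ∞) g) :
    (pd d j)^[n] (fun x => f x • g x) = fun x => ∑ p ∈ Finset.HasAntidiagonal.antidiagonal n,
      n.choose p.1 • ((pd d j)^[p.1] f x • (pd d j)^[p.2] g x) := by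
  induction n with
  | zero => simp
  | succ n ih =>
    have hF := fun k => contDiff_iterate_pd j k hf
    have hG := fun k => contDiff_iterate_pd j k hg
    rw [Function.iterate_succ_apply', ih,
      pd_sum j _ (f := fun (p : ℕ × ℕ) x => n.choose p.1 • ((pd d j)^[p.1] f x • (pd d j)^[p.2] g x))
        fun p => contDiff_nsmul (n.choose p.1) ((hF p.1).smul (hG p.2))]
    funext x
    rw [Finset.sum_antidiagonal_choose_succ_nsmul
      (fun a b => (pd d j)^[a] f x • (pd d j)^[b] g x), ← Finset.sum_add_distrib]
    refine Finset.sum_congr rfl fun p hp => ?_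
    have hch : n.choose p.2 = n.choose p.1 :=
      Nat.choose_symm_of_eq_add (by rw [← Finset.HasAntidiagonal.mem_antidiagonal.mp hp, add_comm])
    rw [pd_nsmul, pd_smul j (hF p.1) (hG p.2), hch]
    simp only [Function.iterate_succ_apply', nsmul_add]

/-- The iterated partial derivative `∂^α` using only the coordinates in the list `l`. -/
def mdOn (l : List (Fin d)) (α : Fin d → ℕ) (f : Ed d → F) : Ed d → F :=
  l.foldr (fun j g => (pd d j)^[α j] g) f

theorem mdOn_cons (j : Fin d) (l : List (Fin d)) (α : Fin d → ℕ) (f : Ed d → F) :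
    mdOn (j :: l) α f = (pd d j)^[α j] (mdOn l α f) := rfl

theorem contDiff_mdOn (l : List (Fin d)) (α : Fin d → ℕ) {f : Ed d → F}
    (hf : ContDiff ℝ (⊤ : ℕ∞) f) : ContDiff ℝ (⊤ : ℕ∞) (mdOn l α f) := by
  induction l with
  | nil => exact hf
  | cons j l ih => exact contDiff_iterate_pd j _ ih

theorem mdOn_congr {l : List (Fin d)} {α β : Fin d → ℕ} (h : ∀ i ∈ l, α i = β i)
    (f : Ed d → F) : mdOn l α f = mdOn l β f := by
  induction l with
  | nil => rfl
  | cons j l ih =>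
    rw [mdOn_cons, mdOn_cons, h j (by simp), ih fun i hi => h i (by simp [hi])]

/-- The multi-indices `β ≤ α` supported in the list `l`. -/
def subIndices (l : List (Fin d)) (α : Fin d → ℕ) : Finset (Fin d → ℕ) :=
  (Finset.Iic α).filter fun β => ∀ i ∉ l, β i = 0

theorem mchoose_update {α β : Fin d → ℕ} {j : Fin d} (hβ : β j = 0) (k : ℕ) :
    mchoose α (Function.update β j k) = (α j).choose k * mchoose α β := by
  unfold mchoose
  rw [← Finset.mul_prod_erase _ _ (Finset.mem_univ j),
    ← Finset.mul_prod_erase _ (fun i => (α i).choose (β i)) (Finset.mem_univ j)]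
  simp only [Function.update_self, hβ, Nat.choose_zero_right, one_mul]
  congr 1
  refine Finset.prod_congr rfl fun i hi => ?_
  rw [Function.update_of_ne (Finset.ne_of_mem_erase hi)]

theorem sum_subIndices_cons {M : Type*} [AddCommMonoid M] {j : Fin d} {l : List (Fin d)}
    (hj : j ∉ l) (α : Fin d → ℕ) (G : (Fin d → ℕ) → M) :
    ∑ β ∈ subIndices (j :: l) α, G β =
      ∑ β ∈ subIndices l α, ∑ p ∈ Finset.HasAntidiagonal.antidiagonal (α j), G (Function.update β j p.1) := by
  rw [← Finset.sum_product']
  symm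
  refine Finset.sum_bij' (fun q _ => Function.update q.1 j q.2.1)
    (fun β _ => (Function.update β j 0, (β j, α j - β j))) ?_ ?_ ?_ ?_ ?_
  · rintro ⟨β, p⟩ h
    simp only [subIndices, Finset.mem_product, Finset.mem_filter, Finset.mem_Iic,
      Finset.HasAntidiagonal.mem_antidiagonal, List.mem_cons, not_or] at h ⊢
    refine ⟨fun i => ?_, fun i hi => ?_⟩
    · by_cases hij : i = j
      · subst hij; simp; omega
      · simpa [hij] using h.1.1 i
    · simpa [hi.1] using h.1.2 i hi.2
  · intro β h
    simp only [subIndices, Finset.mem_product, Finset.mem_filter, Finset.mem_Iic,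
      Finset.HasAntidiagonal.mem_antidiagonal, List.mem_cons, not_or] at h ⊢
    refine ⟨⟨fun i => ?_, fun i hi => ?_⟩, Nat.add_sub_of_le (h.1 j)⟩
    · by_cases hij : i = j
      · subst hij; simp
      · simpa [hij] using h.1 i
    · by_cases hij : i = j
      · subst hij; simp
      · simpa [hij] using h.2 i ⟨hij, hi⟩
  · rintro ⟨β, p⟩ h
    simp only [subIndices, Finset.mem_product, Finset.mem_filter, Finset.mem_Iic,
      Finset.HasAntidiagonal.mem_antidiagonal] at h
    have h0 := h.1.2 j hj
    ext i
    · by_cases hij : i = j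
      · subst hij; simp [h0]
      · simp [hij]
    · simp
    · simp; omega
  · intro β h
    simp
  · intro q h
    rfl

theorem mdOn_smul {l : List (Fin d)} (hl : l.Nodup) (α : Fin d → ℕ) {f : Ed d → ℝ}
    {g : Ed d → F} (hf : ContDiff ℝ (⊤ : ℕ∞) f) (hg : ContDiff ℝ (⊤ : ℕ∞) g) :
    mdOn l α (fun x => f x • g x) = fun x => ∑ β ∈ subIndices l α,
      mchoose α β • (mdOn l β f x • mdOn l (α - β) g x) := by
  induction l with
  | nil =>
    have h : subIndices ([] : List (Fin d)) α = {0} := by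
      ext β
      simp only [subIndices, Finset.mem_filter, Finset.mem_Iic, List.not_mem_nil,
        not_false_eq_true, forall_const, Finset.mem_singleton]
      exact ⟨fun h => funext h.2, by rintro rfl; simp⟩
    funext x
    simp [h, mdOn, mchoose]
  | cons j l ih =>
    obtain ⟨hj, hl⟩ := List.nodup_cons.mp hl
    rw [mdOn_cons, ih hl, iterate_pd_sum_nsmul j (α j) _ _
      (f := fun β x => mdOn l β f x • mdOn l (α - β) g x)
      fun β => (contDiff_mdOn l β hf).smul (contDiff_mdOn l (α - β) hg)]
    funext x
    rw [sum_subIndices_cons hj]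
    refine Finset.sum_congr rfl fun β hβ => ?_
    have h0 : β j = 0 := (Finset.mem_filter.mp hβ).2 j hj
    rw [iterate_pd_smul j (α j) (contDiff_mdOn l β hf) (contDiff_mdOn l (α - β) hg),
      Finset.smul_sum]
    refine Finset.sum_congr rfl fun p hp => ?_
    have hp' : α j - p.1 = p.2 := by
      have := Finset.HasAntidiagonal.mem_antidiagonal.mp hp; omega
    have hne : ∀ i ∈ l, i ≠ j := fun i hi hij => hj (hij ▸ hi)
    rw [mchoose_update h0, mdOn_cons, mdOn_cons, Pi.sub_apply, Function.update_self, hp',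
      mdOn_congr (α := Function.update β j p.1) (β := β) (fun i hi => by simp [hne i hi]) f,
      mdOn_congr (α := α - Function.update β j p.1) (β := α - β)
        (fun i hi => by simp [hne i hi]) g, smul_smul, mul_comm]

/-- Multi-index Leibniz rule. -/
theorem md_smul (α : Fin d → ℕ) {f : Ed d → ℝ} {g : Ed d → F}
    (hf : ContDiff ℝ (⊤ : ℕ∞) f) (hg : ContDiff ℝ (⊤ : ℕ∞) g) (x : Ed d) :
    md α (fun y => f y • g y) x =
      ∑ β ∈ Finset.Iic α, mchoose α β • (md β f x • md (α - β) g x) := by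
  have h := congrFun (mdOn_smul (List.nodup_finRange d) α hf hg) x
  have hs : subIndices (List.finRange d) α = Finset.Iic α := by
    simp [subIndices]
  rwa [hs] at h

end MultiIndexDerivatives

section Schwartz

variable {d : ℕ}

theorem exists_schwartzMap_eq_pd (j : Fin d) (u : SchwartzMap (Ed d) ℂ) :
    ∃ v : SchwartzMap (Ed d) ℂ, ⇑v = pd d j ⇑u :=
  ⟨LineDeriv.lineDerivOp (EuclideanSpace.single j (1 : ℝ)) u, by
    funext x
    exact SchwartzMap.lineDerivOp_apply_eq_fderiv _ _ _⟩

theorem exists_schwartzMap_eq_md (α : Fin d → ℕ) (u : SchwartzMap (Ed d) ℂ) :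
    ∃ v : SchwartzMap (Ed d) ℂ, ⇑v = md α ⇑u := by
  unfold md
  induction List.finRange d with
  | nil => exact ⟨u, rfl⟩
  | cons j l ih =>
    rw [List.foldr_cons]
    induction α j with
    | zero => exact ih
    | succ n ihn =>
      obtain ⟨v, hv⟩ := ihn
      rw [Function.iterate_succ_apply', ← hv]
      exact exists_schwartzMap_eq_pd j v

theorem integrable_norm_sq_md (α : Fin d → ℕ) (u : SchwartzMap (Ed d) ℂ) :
    Integrable fun x => ‖md α ⇑u x‖ ^ 2 := by
  obtain ⟨v, hv⟩ := exists_schwartzMap_eq_md α u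
  rw [← hv]
  exact (v.memLp 2 volume).integrable_norm_pow (by simp)

theorem l2sq_nonneg (f : Ed d → ℂ) : 0 ≤ l2sq f :=
  integral_nonneg fun _ => by positivity

end Schwartz

section MultiIndex

variable {d : ℕ}

theorem mfact_eq_mul {α β : Fin d → ℕ} (h : β ≤ α) :
    mchoose α β * mfact β * mfact (α - β) = mfact α := by
  simp only [mchoose, mfact, ← Finset.prod_mul_distrib]
  exact Finset.prod_congr rfl fun i _ => Nat.choose_mul_factorial_mul_factorial (h i)

theorem mfact_pos (α : Fin d → ℕ) : 0 < mfact α :=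
  Finset.prod_pos fun _ _ => Nat.factorial_pos _

theorem mlen_add_mlen_sub {α β : Fin d → ℕ} (h : β ≤ α) :
    mlen β + mlen (α - β) = mlen α := by
  simp only [mlen, ← Finset.sum_add_distrib]
  exact Finset.sum_congr rfl fun i _ => Nat.add_sub_of_le (h i)

theorem one_le_mlen {β : Fin d → ℕ} (h : β ≠ 0) : 1 ≤ mlen β := by
  by_contra hc
  refine h (funext fun i => ?_)
  have : mlen β = 0 := by omega
  exact Finset.sum_eq_zero_iff.mp this i (Finset.mem_univ i)

theorem mem_MI {N : ℕ} {α : Fin d → ℕ} : α ∈ MI d N ↔ mlen α ≤ N := by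
  simp only [MI, Finset.mem_filter, Finset.mem_Iic, mlen, and_iff_right_iff_imp]
  exact fun h i => (Finset.single_le_sum (f := α) (fun _ _ => Nat.zero_le _)
    (Finset.mem_univ i)).trans h

theorem mem_MI_of_le {N : ℕ} {α β : Fin d → ℕ} (h : β ≤ α) (hα : α ∈ MI d N) : β ∈ MI d N := by
  rw [mem_MI] at *
  exact (Finset.sum_le_sum fun i _ => h i).trans hα

theorem sum_MI_half_pow_le (d N : ℕ) : ∑ β ∈ MI d N, (1 / 2 : ℝ) ^ mlen β ≤ 2 ^ d := by
  calc ∑ β ∈ MI d N, (1 / 2 : ℝ) ^ mlen β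
      ≤ ∑ β ∈ Fintype.piFinset fun _ : Fin d => Finset.range (N + 1),
          ∏ j, (1 / 2 : ℝ) ^ β j := by
        simp only [Finset.prod_pow_eq_pow_sum]
        refine Finset.sum_le_sum_of_subset_of_nonneg (fun β hβ => ?_) fun _ _ _ => by positivity
        simp only [Fintype.mem_piFinset, Finset.mem_range, Nat.lt_succ_iff]
        exact Finset.mem_Iic.mp (Finset.mem_filter.mp hβ).1
    _ = ∏ _j : Fin d, ∑ k ∈ Finset.range (N + 1), (1 / 2 : ℝ) ^ k :=
        (Finset.prod_univ_sum _ _).symm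
    _ ≤ ∏ _j : Fin d, (2 : ℝ) :=
        Finset.prod_le_prod (fun _ _ => by positivity) fun _ _ => sum_geometric_two_le _
    _ = 2 ^ d := by simp

/-- A discrete Young inequality for convolution with the weights `2^{-|β|}`. -/
theorem sum_MI_convolution_le (N : ℕ) {w : (Fin d → ℕ) → ℝ} (hw : ∀ α, 0 ≤ w α) :
    ∑ α ∈ MI d N, ∑ β ∈ Finset.Iic α, (1 / 2 : ℝ) ^ mlen β * ((w (α - β) + w α) / 2) ≤
      2 ^ d * ∑ α ∈ MI d N, w α := by
  classical
  have hS : 0 ≤ ∑ α ∈ MI d N, w α := Finset.sum_nonneg fun α _ => hw α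
  rw [Finset.sum_comm' (t' := MI d N) (s' := fun β => (MI d N).filter (β ≤ ·))
    (fun α β => by
      simp only [Finset.mem_Iic, Finset.mem_filter]
      exact ⟨fun h => ⟨h, mem_MI_of_le h.2 h.1⟩, fun h => h.1⟩)]
  refine le_trans (Finset.sum_le_sum fun β _ => ?_)
    (le_of_eq_of_le (Finset.sum_mul _ _ _).symm
      (mul_le_mul_of_nonneg_right (sum_MI_half_pow_le d N) hS))
  rw [← Finset.mul_sum]
  refine mul_le_mul_of_nonneg_left ?_ (by positivity)
  rw [← Finset.sum_div, Finset.sum_add_distrib]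
  have h1 : ∑ α ∈ (MI d N).filter (β ≤ ·), w α ≤ ∑ α ∈ MI d N, w α :=
    Finset.sum_le_sum_of_subset_of_nonneg (Finset.filter_subset _ _) fun α _ _ => hw α
  have h2 : ∑ α ∈ (MI d N).filter (β ≤ ·), w (α - β) ≤ ∑ α ∈ MI d N, w α := by
    have hinj : Set.InjOn (fun α : Fin d → ℕ => α - β) ((MI d N).filter (β ≤ ·)) := by
      intro a ha b hb hab
      simp only [Finset.coe_filter, Set.mem_ofPred_eq] at ha hb
      simpa only [tsub_add_cancel_of_le ha.2, tsub_add_cancel_of_le hb.2] using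
        congrArg (· + β) hab
    rw [← Finset.sum_image hinj]
    refine Finset.sum_le_sum_of_subset_of_nonneg (fun γ hγ => ?_) fun α _ _ => hw α
    obtain ⟨α, hα, rfl⟩ := Finset.mem_image.mp hγ
    exact mem_MI_of_le tsub_le_self (Finset.mem_filter.mp hα).1
  linarith

end MultiIndex

theorem abs_re_integral_le {X : Type*} [MeasurableSpace X] {μ : Measure X} {f : X → ℂ}
    {g : X → ℝ} (hg : Integrable g μ) (h : ∀ x, |(f x).re| ≤ g x) :
    |(∫ x, f x ∂μ).re| ≤ ∫ x, g x ∂μ := by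
  by_cases hf : Integrable f μ
  · have hre : (∫ x, f x ∂μ).re = ∫ x, (f x).re ∂μ := (integral_re hf).symm
    rw [hre]
    exact norm_integral_le_of_norm_le hg (Eventually.of_forall fun x => (Real.norm_eq_abs _).trans_le (h x))
  · rw [integral_undef hf, zero_re, abs_zero]
    exact integral_nonneg fun x => (abs_nonneg _).trans (h x)

section EnergyEstimate

variable {d : ℕ} {C : ℝ} {W : Ed d → ℝ}

/-- Bound for one term of the Leibniz expansion of the energy form. -/
theorem leibniz_term_le (hC : 0 < C) {α β : Fin d → ℕ} (hβα : β ≤ α) {m a b : ℝ}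
    (hm : |m| ≤ C ^ (mlen β + 1) * (mfact β : ℝ)) (ha : 0 ≤ a) (hb : 0 ≤ b) :
    (1 / (2 * C)) ^ (2 * mlen α) / (mfact α : ℝ) ^ 2 * (mchoose α β * (|m| * a) * b) ≤
      C * ((1 / 2 : ℝ) ^ mlen β *
        (((1 / (2 * C)) ^ (2 * mlen (α - β)) / (mfact (α - β) : ℝ) ^ 2 * a ^ 2 +
          (1 / (2 * C)) ^ (2 * mlen α) / (mfact α : ℝ) ^ 2 * b ^ 2) / 2)) := by
  set ε : ℝ := 1 / (2 * C) with hε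
  have hεpos : 0 < ε := by positivity
  have hfac : (mfact α : ℝ) = mchoose α β * mfact β * mfact (α - β) := by
    exact_mod_cast (mfact_eq_mul hβα).symm
  have hα0 : (mfact α : ℝ) ≠ 0 := by exact_mod_cast (mfact_pos α).ne'
  have hγ0 : (mfact (α - β) : ℝ) ≠ 0 := by exact_mod_cast (mfact_pos (α - β)).ne'
  have hβ0 : (mfact β : ℝ) ≠ 0 := by exact_mod_cast (mfact_pos β).ne'
  have hεC : (1 / 2 : ℝ) = ε * C := by rw [hε]; field_simp
  set A := ε ^ mlen (α - β) / (mfact (α - β) : ℝ) * a with hA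
  set B := ε ^ mlen α / (mfact α : ℝ) * b with hB
  calc ε ^ (2 * mlen α) / (mfact α : ℝ) ^ 2 * (mchoose α β * (|m| * a) * b)
      ≤ ε ^ (2 * mlen α) / (mfact α : ℝ) ^ 2 *
          (mchoose α β * (C ^ (mlen β + 1) * (mfact β : ℝ) * a) * b) := by gcongr
    _ = C * ((1 / 2 : ℝ) ^ mlen β * (A * B)) := by
        have hch : (mchoose α β : ℝ) = mfact α / (mfact β * mfact (α - β)) := by
          rw [hfac]; field_simp
        have hpow : ε ^ (2 * mlen α) = ε ^ mlen β * ε ^ mlen (α - β) * ε ^ mlen α := by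
          rw [two_mul, pow_add, ← pow_add ε (mlen β), mlen_add_mlen_sub hβα]
        rw [hch, hpow, hεC, mul_pow, hA, hB]
        field_simp
        ring
    _ ≤ C * ((1 / 2 : ℝ) ^ mlen β * ((A ^ 2 + B ^ 2) / 2)) := by
        gcongr
        nlinarith [sq_nonneg (A - B)]
    _ = _ := by
        rw [hA, hB]
        simp only [mul_pow, div_pow, ← pow_mul, mul_comm 2]

theorem abs_re_mul_md_le (hW : ContDiff ℝ (⊤ : ℕ∞) W) {u : Ed d → ℂ}
    (hu : ContDiff ℝ (⊤ : ℕ∞) u) (α : Fin d → ℕ) (x : Ed d) :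
    |(I * md α (fun y => (W y : ℂ) * u y) x * starRingEnd ℂ (md α u x)).re| ≤
      ∑ β ∈ (Finset.Iic α).erase 0,
        mchoose α β * (|md β W x| * ‖md (α - β) u x‖) * ‖md α u x‖ := by
  have hL := md_smul α hW hu x
  simp only [Complex.real_smul] at hL
  rw [hL, ← Finset.add_sum_erase _ _ (Finset.mem_Iic.mpr (zero_le : 0 ≤ α))]
  have h0 : (I * (mchoose α 0 • (((md 0 W x : ℝ) : ℂ) * md (α - 0) u x)) *
      starRingEnd ℂ (md α u x)).re = 0 := by
    have : I * (mchoose α 0 • (((md 0 W x : ℝ) : ℂ) * md (α - 0) u x)) * starRingEnd ℂ (md α u x) =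
        I * ((md 0 W x * normSq (md α u x) : ℝ) : ℂ) := by
      rw [tsub_zero, ofReal_mul, normSq_eq_conj_mul_self]
      simp only [mchoose, Pi.zero_apply, Nat.choose_zero_right, Finset.prod_const_one, one_smul]
      ring
    rw [this, I_mul_re, ofReal_im, neg_zero]
  rw [mul_add, add_mul, add_re, h0, zero_add]
  refine (abs_re_le_norm _).trans ?_
  rw [norm_mul, norm_mul, norm_I, one_mul, RCLike.norm_conj, ← Finset.sum_mul]
  refine mul_le_mul_of_nonneg_right (norm_sum_le_of_le _ fun β _ => ?_) (norm_nonneg _)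
  rw [nsmul_eq_mul, norm_mul, norm_mul, norm_natCast, norm_real, Real.norm_eq_abs]

theorem energy_term_le (hC : 0 < C) (hW : ContDiff ℝ (⊤ : ℕ∞) W)
    (hWbd : ∀ β : Fin d → ℕ, 1 ≤ mlen β → ∀ x,
      |md β W x| ≤ C ^ (mlen β + 1) * (mfact β : ℝ))
    (u : SchwartzMap (Ed d) ℂ) (α : Fin d → ℕ) :
    (1 / (2 * C)) ^ (2 * mlen α) / (mfact α : ℝ) ^ 2 *
        |(ip (fun x => I * md α (fun y => (W y : ℂ) * u y) x) (md α ⇑u)).re| ≤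
      C * ∑ β ∈ Finset.Iic α, (1 / 2 : ℝ) ^ mlen β *
        (((1 / (2 * C)) ^ (2 * mlen (α - β)) / (mfact (α - β) : ℝ) ^ 2 * l2sq (md (α - β) ⇑u) +
          (1 / (2 * C)) ^ (2 * mlen α) / (mfact α : ℝ) ^ 2 * l2sq (md α ⇑u)) / 2) := by
  set c : (Fin d → ℕ) → ℝ := fun γ => (1 / (2 * C)) ^ (2 * mlen γ) / (mfact γ : ℝ) ^ 2 with hc
  have hc0 : ∀ γ, 0 ≤ c γ := fun γ => by positivity
  set g : (Fin d → ℕ) → Ed d → ℝ := fun β x => (1 / 2 : ℝ) ^ mlen β *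
    ((c (α - β) * ‖md (α - β) ⇑u x‖ ^ 2 + c α * ‖md α ⇑u x‖ ^ 2) / 2) with hg
  have hgint : ∀ β, Integrable (g β) := fun β =>
    ((((integrable_norm_sq_md (α - β) u).const_mul _).add
      ((integrable_norm_sq_md α u).const_mul _)).div_const 2).const_mul _
  have hint : ∫ x, C * ∑ β ∈ Finset.Iic α, g β x = C * ∑ β ∈ Finset.Iic α,
      (1 / 2 : ℝ) ^ mlen β * ((c (α - β) * l2sq (md (α - β) ⇑u) + c α * l2sq (md α ⇑u)) / 2) := by
    rw [integral_const_mul, integral_finsetSum _ fun β _ => hgint β]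
    congr 1
    refine Finset.sum_congr rfl fun β _ => ?_
    rw [hg, integral_const_mul, integral_div, integral_add
      ((integrable_norm_sq_md (α - β) u).const_mul _) ((integrable_norm_sq_md α u).const_mul _),
      integral_const_mul, integral_const_mul]
    rfl
  have hre : c α * |(ip (fun x => I * md α (fun y => (W y : ℂ) * u y) x) (md α ⇑u)).re| =
      |(∫ x, (c α : ℂ) * (I * md α (fun y => (W y : ℂ) * u y) x *
        starRingEnd ℂ (md α ⇑u x))).re| := by
    rw [integral_const_mul, re_ofReal_mul, abs_mul, abs_of_nonneg (hc0 α)]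
    rfl
  change c α * _ ≤ _
  rw [hre, ← hint]
  refine abs_re_integral_le ((integrable_finsetSum _ fun β _ => hgint β).const_mul C)
    fun x => ?_
  rw [re_ofReal_mul, abs_mul, abs_of_nonneg (hc0 α), Finset.mul_sum]
  refine (mul_le_mul_of_nonneg_left (abs_re_mul_md_le hW (u.smooth ⊤) α x) (hc0 α)).trans ?_
  rw [Finset.mul_sum]
  refine (Finset.sum_le_sum fun β hβ => ?_).trans
    (Finset.sum_le_sum_of_subset_of_nonneg (Finset.erase_subset 0 _) fun β _ _ => ?_)
  · obtain ⟨hne, hle⟩ := Finset.mem_erase.mp hβ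
    exact leibniz_term_le hC (Finset.mem_Iic.mp hle) (hWbd β (one_le_mlen hne) x)
      (norm_nonneg _) (norm_nonneg _)
  · have := hc0 (α - β)
    have := hc0 α
    positivity

end EnergyEstimate

/-- Bound for the analytic-scale energy form
`|Re ℰ^ε_N[iWu, u]| ≤ C' ℰ^ε_N[u,u]` (Lemma 6.2, second part, for the
drift/multiplication operator `iW`). The constants `ε, C'` are independent of `N`. -/
theorem statement15 (d : ℕ) (hd : 1 ≤ d) (C : ℝ) (hC : 0 < C)
    (W : Ed d → ℝ) (hWsmooth : ContDiff ℝ (⊤ : ℕ∞) W)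
    (hWbd : ∀ β : Fin d → ℕ, 1 ≤ mlen β → ∀ x,
      |md β W x| ≤ C ^ (mlen β + 1) * (mfact β : ℝ)) :
    ∃ ε > (0 : ℝ), ∃ C' > (0 : ℝ), ∀ N : ℕ, ∀ u : SchwartzMap (Ed d) ℂ,
      |(∑ α ∈ MI d N, (((ε ^ (2 * mlen α) / (mfact α : ℝ) ^ 2 : ℝ)) : ℂ) *
          ip (fun x => Complex.I * md α (fun y => (W y : ℂ) * u y) x) (md α ⇑u)).re|
        ≤ C' * ∑ α ∈ MI d N, (ε ^ (2 * mlen α) / (mfact α : ℝ) ^ 2) * l2sq (md α ⇑u) := by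
  have hw : ∀ α : Fin d → ℕ, 0 ≤ (1 / (2 * C)) ^ (2 * mlen α) / (mfact α : ℝ) ^ 2 :=
    fun α => by positivity
  refine ⟨1 / (2 * C), by positivity, C * 2 ^ d, by positivity, fun N u => ?_⟩
  have hconv := sum_MI_convolution_le N
    (w := fun α => (1 / (2 * C)) ^ (2 * mlen α) / (mfact α : ℝ) ^ 2 * l2sq (md α ⇑u))
    fun α => mul_nonneg (hw α) (l2sq_nonneg _)
  rw [re_sum, mul_assoc]
  refine (Finset.abs_sum_le_sum_abs _ _).trans (le_trans (Finset.sum_le_sum fun α _ => ?_)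
    (le_of_eq_of_le (Finset.mul_sum _ _ _).symm (mul_le_mul_of_nonneg_left hconv hC.le)))
  rw [re_ofReal_mul, abs_mul, abs_of_nonneg (hw α)]
  exact energy_term_le hC hWsmooth hWbd u α
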